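/- Let A(p) = k⟨x₁,x₂⟩/(x₂x₁² − p²x₁²x₂, x₂²x₁x₂x₁ + p x₂x₁x₂²x₁ − p³x₁x₂²x₁x₂ − p⁴x₁x₂x₁x₂², x₂⁴x₁ − p⁴x₁x₂⁴) for p ≠ 0 in k. Then the element z = x₂³x₁ + p x₂²x₁x₂ + p² x₂x₁x₂² + p³ x₁x₂³ is a regular normal element of A(p). -/

import Mathlib

namespace Stmt14

variable (k : Type) [Field k]

/-- The generator `x₁` (of degree `(1,0)`). -/
noncomputable def x1 : FreeAlgebra k (Fin 2) := FreeAlgebra.ι k 0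
/-- The generator `x₂` (of degree `(0,1)`). -/
noncomputable def x2 : FreeAlgebra k (Fin 2) := FreeAlgebra.ι k 1

/-- The defining relations of the algebra `𝒜(p)`:
`f₁ = x₂x₁² − p²x₁²x₂`,
`f₂ = x₂²x₁x₂x₁ + p x₂x₁x₂²x₁ − p³x₁x₂²x₁x₂ − p⁴x₁x₂x₁x₂²`,
`f₃ = x₂⁴x₁ − p⁴x₁x₂⁴`. -/
def relA (p : k) : FreeAlgebra k (Fin 2) → FreeAlgebra k (Fin 2) → Prop := fun a b =>
  (a = x2 k * x1 k ^ 2 ∧ b = p ^ 2 • (x1 k ^ 2 * x2 k)) ∨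
  (a = x2 k ^ 2 * x1 k * x2 k * x1 k + p • (x2 k * x1 k * x2 k ^ 2 * x1 k) ∧
    b = p ^ 3 • (x1 k * x2 k ^ 2 * x1 k * x2 k) + p ^ 4 • (x1 k * x2 k * x1 k * x2 k ^ 2)) ∨
  (a = x2 k ^ 4 * x1 k ∧ b = p ^ 4 • (x1 k * x2 k ^ 4))

/-- The algebra `𝒜(p) = k⟨x₁,x₂⟩/(f₁, f₂, f₃)`. -/
abbrev AlgA (p : k) := RingQuot (relA k p)

/-- The element `z = x₂³x₁ + p x₂²x₁x₂ + p² x₂x₁x₂² + p³ x₁x₂³`. -/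
noncomputable def zElt (p : k) : FreeAlgebra k (Fin 2) :=
  x2 k ^ 3 * x1 k + p • (x2 k ^ 2 * x1 k * x2 k) + p ^ 2 • (x2 k * x1 k * x2 k ^ 2) +
    p ^ 3 • (x1 k * x2 k ^ 3)


section helpers
variable {k}

/-- The three relations for a pair of elements. -/
structure Rel {R : Type*} [Ring R] [Algebra k R] (p : k) (x y : R) : Prop where
  r1 : y * x ^ 2 = p ^ 2 • (x ^ 2 * y)
  r2 : y ^ 2 * x * y * x + p • (y * x * y ^ 2 * x) =
    p ^ 3 • (x * y ^ 2 * x * y) + p ^ 4 • (x * y * x * y ^ 2)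
  r3 : y ^ 4 * x = p ^ 4 • (x * y ^ 4)

/-- The element `z` for a pair of elements. -/
def zE {R : Type*} [Ring R] [Algebra k R] (p : k) (x y : R) : R :=
  y ^ 3 * x + p • (y ^ 2 * x * y) + p ^ 2 • (y * x * y ^ 2) + p ^ 3 • (x * y ^ 3)

section twist
variable {R : Type*} [Ring R] [Algebra k R]

lemma twist_pow {u : k} {x P : R} (h : P * x = u • (x * P)) (n : ℕ) :
    P ^ n * x = u ^ n • (x * P ^ n) := by
  induction n with
  | zero => simp
  | succ n ih =>
    rw [pow_succ P, mul_assoc, h, mul_smul_comm, ← mul_assoc, ih, smul_mul_assoc, smul_smul,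
      mul_assoc, pow_succ u, mul_comm u]

lemma twist_rel {p u : k} {x y P : R} (hx : P * x = u • (x * P)) (hy : P * y = y * P)
    (h : Rel p x y) : Rel (p * u) x (y * P) := by
  have hx' : ∀ w, P * (x * w) = u • (x * (P * w)) := fun w => by
    rw [← mul_assoc, hx, smul_mul_assoc, mul_assoc]
  have hy' : ∀ w, P * (y * w) = y * (P * w) := fun w => by
    rw [← mul_assoc, hy, mul_assoc]
  obtain ⟨r1, r2, r3⟩ := h
  refine ⟨?_, ?_, ?_⟩
  · have := congrArg (fun t => u ^ 2 • (t * P)) r1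
    simp only [pow_succ, pow_zero, one_mul, mul_assoc, hx, hy, hx', hy', mul_smul_comm,
      smul_mul_assoc, smul_smul, add_mul, smul_add] at this ⊢
    rw [this]; module
  · have := congrArg (fun t => u ^ 5 • (t * P ^ 3)) r2
    simp only [pow_succ, pow_zero, one_mul, mul_assoc, hx, hy, hx', hy', mul_smul_comm,
      smul_mul_assoc, smul_smul, add_mul, smul_add] at this ⊢
    linear_combination (norm := module) this
  · have := congrArg (fun t => u ^ 4 • (t * P ^ 4)) r3
    simp only [pow_succ, pow_zero, one_mul, mul_assoc, hx, hy, hx', hy', mul_smul_comm,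
      smul_mul_assoc, smul_smul, add_mul, smul_add] at this ⊢
    linear_combination (norm := module) this

lemma twist_z {p u : k} {x y P : R} (hx : P * x = u • (x * P)) (hy : P * y = y * P) :
    zE (p * u) x (y * P) = u ^ 3 • (zE p x y * P ^ 3) := by
  have hx' : ∀ w, P * (x * w) = u • (x * (P * w)) := fun w => by
    rw [← mul_assoc, hx, smul_mul_assoc, mul_assoc]
  have hy' : ∀ w, P * (y * w) = y * (P * w) := fun w => by
    rw [← mul_assoc, hy, mul_assoc]
  simp only [zE, pow_succ, pow_zero, one_mul, mul_assoc, hx, hy, hx', hy', mul_smul_comm,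
      smul_mul_assoc, smul_smul, add_mul, smul_add]
  module

lemma z_y {p : k} {x y : R} (h : Rel p x y) : y * zE p x y = p • (zE p x y * y) := by
  have := h.r3
  simp only [zE, pow_succ, pow_zero, one_mul, mul_assoc, mul_smul_comm,
      smul_mul_assoc, smul_smul, add_mul, mul_add, smul_add] at this ⊢
  linear_combination (norm := module) this

lemma z_x {p : k} {x y : R} (h : Rel p x y) : zE p x y * x = p ^ 3 • (x * zE p x y) := by
  have h2 := h.r2
  have h1 := h.r1
  have e : y ^ 3 * x * x = p ^ 6 • (x * (x * y ^ 3)) := by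
    have a1 := congrArg (fun t => y * (y * t)) h1
    have a2 := congrArg (fun t => y * (t * y)) h1
    have a3 := congrArg (fun t => t * y * y) h1
    simp only [pow_succ, pow_zero, one_mul, mul_assoc, mul_smul_comm,
      smul_mul_assoc, smul_smul] at a1 a2 a3 ⊢
    rw [a1, a2, a3]; module
  simp only [zE, pow_succ, pow_zero, one_mul, mul_assoc, mul_smul_comm,
      smul_mul_assoc, smul_smul, add_mul, mul_add, smul_add] at h2 e ⊢
  linear_combination (norm := module) e + p • h2

end twist

/-- coefficient sequences -/
def oc (k : Type) [Field k] : ℕ → k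
  | 0 => 0
  | n + 1 => 1 - oc k n
section formula
variable {R : Type*} [Ring R] [Algebra k R]

/-- auxiliary commutation relations -/
structure Comm (x y y1 y2 z : R) : Prop where
  a0 : y * x = y1 - x * y
  a1 : y * y1 = y1 * y + y2
  a2 : y * y2 = z - y2 * y - 2 * (y1 * (y * y))
  yz : y * z = z * y
  xz : x * z = z * x
  b1 : y1 * x = x * y1
  b2 : y2 * x = -(x * y2)
  b3 : y2 * y1 = -(y1 * y2)
  b4 : y * y * y2 = - (y2 * (y * y))
  y1z : y1 * z = z * y1
  y2z : y2 * z = z * y2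

lemma mk_comm {x y : R} (h : Rel (1 : k) x y) :
    ∃ y1 y2, Comm x y y1 y2 (zE (1 : k) x y) := by
  have hzx := z_x h
  have hzy := z_y h
  have hz : zE (1 : k) x y = y * (y * (y * x + x * y)) + (y * x + x * y) * y * y := by
    simp only [zE, one_smul, one_pow]; noncomm_ring
  rw [one_pow, one_smul] at hzx
  rw [one_smul] at hzy
  generalize zE (1 : k) x y = z at *
  obtain ⟨y1, hy1⟩ : ∃ y1, y1 = y * x + x * y := ⟨_, rfl⟩
  obtain ⟨y2, hy2⟩ : ∃ y2, y2 = y * y1 - y1 * y := ⟨_, rfl⟩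
  rw [← hy1] at hz
  have a0 : y * x = y1 - x * y := by rw [hy1]; abel
  have a1 : y * y1 = y1 * y + y2 := by rw [hy2]; abel
  have a2 : y * y2 = z - y2 * y - 2 * (y1 * (y * y)) := by
    rw [hz, hy2]; noncomm_ring
  have b1 : y1 * x = x * y1 := by
    have := h.r1
    rw [one_pow, one_smul] at this
    rw [hy1]
    linear_combination (norm := noncomm_ring) this
  have cz : ∀ {s t : R}, s * z = z * s → t * z = z * t → s * t * z = z * (s * t) := by
    intro s t hs ht
    rw [mul_assoc, ht, ← mul_assoc, hs, mul_assoc]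
  have y1z : y1 * z = z * y1 := by
    rw [hy1, add_mul, cz hzy hzx.symm, cz hzx.symm hzy, mul_add]
  have y2z : y2 * z = z * y2 := by
    rw [hy2, sub_mul, cz hzy y1z, cz y1z hzy, mul_sub]
  have b2 : y2 * x = -(x * y2) := by
    linear_combination (norm := noncomm_ring) y * b1 - a1 * x + a0 * y1 - y1 * a0
      - x * a1 + b1 * y
  have wx : y * y * x = x * (y * y) + y2 := by
    linear_combination (norm := noncomm_ring) y * a0 + a1 - a0 * y
  have wy : y * y * y1 = z - y1 * (y * y) := by
    rw [hz]; noncomm_ring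
  have b3 : y2 * y1 = -(y1 * y2) := by
    linear_combination (norm := noncomm_ring) -(wx * y1) - x * wy - y * y * b1
      + wy * x - y1 * wx + hzx - b1 * (y * y)
  have b4 : y * y * y2 = - (y2 * (y * y)) := by
    linear_combination (norm := noncomm_ring) y * a2 - a2 * y + hzy - 2 * a1 * y * y
  exact ⟨y1, y2, a0, a1, a2, hzy, hzx.symm, b1, b2, b3, b4, y1z, y2z⟩

/-- ordered monomials -/
def mon (x y y1 y2 z : R) (a b c d f : ℕ) : R :=
  x ^ a * y1 ^ b * y2 ^ c * z ^ d * y ^ f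

lemma anti_pow {s t : R} (h : s * t = -(t * s)) (n : ℕ) :
    s * t ^ n = (-1 : k) ^ n • (t ^ n * s) := by
  induction n with
  | zero => simp
  | succ n ih =>
    rw [pow_succ, ← mul_assoc, ih, smul_mul_assoc, mul_assoc, h, pow_succ, mul_assoc]
    simp [mul_assoc]

lemma oc_pow (s t : R) (n : ℕ) : s * (oc k n • (s ^ (n - 1) * t)) = oc k n • (s ^ n * t) := by
  cases n with
  | zero => simp [oc]
  | succ m => rw [mul_smul_comm, ← mul_assoc, Nat.add_sub_cancel, pow_succ']

lemma oc_sign (n : ℕ) : (-1 : k) ^ n = 1 - 2 * oc k n := by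
  induction n with
  | zero => simp [oc]
  | succ n ih => rw [pow_succ, ih, oc]; ring

lemma pow_y {x y y1 y2 z : R} (h : Comm x y y1 y2 z) (c : ℕ) :
    y * x ^ c = (-1 : k) ^ c • (x ^ c * y) + oc k c • (x ^ (c - 1) * y1) := by
  have hb : ∀ n, y1 * x ^ n = x ^ n * y1 := fun n => (Commute.pow_right h.b1 n)
  induction c with
  | zero => simp [oc]
  | succ n ih =>
    rw [pow_succ', ← mul_assoc, h.a0, sub_mul, mul_assoc, ih, mul_add, oc_pow, hb, mul_smul_comm,
      Nat.add_sub_cancel]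
    simp only [oc, pow_succ' (-1 : k), mul_assoc]
    module

lemma pow_y1 {x y y1 y2 z : R} (h : Comm x y y1 y2 z) (c : ℕ) :
    y * y1 ^ c = y1 ^ c * y + oc k c • (y1 ^ (c - 1) * y2) := by
  induction c with
  | zero => simp [oc]
  | succ n ih =>
    rw [pow_succ', ← mul_assoc, h.a1, add_mul, mul_assoc, ih, mul_add, oc_pow,
      anti_pow (k := k) h.b3, Nat.add_sub_cancel, oc_sign]
    simp only [oc, mul_assoc]
    module

lemma pow_y2 {x y y1 y2 z : R} (h : Comm x y y1 y2 z) (c : ℕ) :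
    y * y2 ^ c = (-1 : k) ^ c • (y2 ^ c * y) + (-2 * oc k c) • (y1 * (y2 ^ (c - 1) * (y * y)))
      + oc k c • (y2 ^ (c - 1) * z) := by
  have hb : ∀ n, z * y2 ^ n = y2 ^ n * z := fun n => (Commute.pow_right h.y2z.symm n)
  have hw : y * y * y2 ^ c = (-1 : k) ^ c • (y2 ^ c * (y * y)) := anti_pow h.b4 c
  induction c with
  | zero => simp [oc]
  | succ n ih =>
    have hw : y * y * y2 ^ n = (-1 : k) ^ n • (y2 ^ n * (y * y)) := anti_pow h.b4 n
    have e1 : y2 * (oc k n • (y1 * (y2 ^ (n - 1) * (y * y)))) =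
        - oc k n • (y1 * (y2 ^ n * (y * y))) := by
      have := oc_pow (k := k) y2 (y * y) n
      rw [mul_smul_comm] at this ⊢
      rw [← mul_assoc, h.b3, neg_mul, mul_assoc, smul_neg, ← mul_smul_comm, this,
        mul_smul_comm, neg_smul]
    rw [pow_succ', ← mul_assoc, h.a2, sub_mul, sub_mul, mul_assoc y2 y, ih hw, mul_add, mul_add,
      oc_pow, hb, mul_smul_comm, Nat.add_sub_cancel, mul_smul, mul_smul_comm (-2 : k), e1,
      mul_assoc 2, mul_assoc y1, hw, two_mul]
    simp only [oc, pow_succ' (-1 : k), mul_assoc, mul_smul_comm, oc_sign]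
    module

lemma x_mon (x y y1 y2 z : R) (a b c d f : ℕ) :
    x * mon x y y1 y2 z a b c d f = mon x y y1 y2 z (a + 1) b c d f := by
  simp only [mon, pow_succ' x a, mul_assoc]

lemma y_mon {x y y1 y2 z : R} (h : Comm x y y1 y2 z) (a b c d f : ℕ) :
    y * mon x y y1 y2 z a b c d f =
      ((-1 : k) ^ a * (-1) ^ c) • mon x y y1 y2 z a b c d (f + 1)
      + ((-1) ^ a * (-2 * oc k c)) • mon x y y1 y2 z a (b + 1) (c - 1) d (f + 1 + 1)
      + ((-1) ^ a * oc k c) • mon x y y1 y2 z a b (c - 1) (d + 1) f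
      + ((-1) ^ a * oc k b) • mon x y y1 y2 z a (b - 1) (c + 1) d f
      + oc k a • mon x y y1 y2 z (a - 1) (b + 1) c d f := by
  have hz : y * z ^ d = z ^ d * y := Commute.pow_right h.yz d
  have hz' : ∀ t, y * (z ^ d * t) = z ^ d * (y * t) := fun t => by
    rw [← mul_assoc, hz, mul_assoc]
  have h0 := pow_y (k := k) h a
  have h1 := pow_y1 (k := k) h b
  have h2 := pow_y2 (k := k) h c
  simp only [mon]
  rw [← mul_assoc, ← mul_assoc, ← mul_assoc, ← mul_assoc, h0]
  simp only [add_mul, smul_mul_assoc]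
  rw [mul_assoc (x ^ a) y, h1, mul_add, mul_smul_comm, add_mul, smul_mul_assoc, ← mul_assoc,
    mul_assoc (x ^ a * _) y, h2]
  simp only [pow_succ' _ f, pow_succ' y (f + 1), pow_succ' _ c, pow_succ' _ d, mul_add, add_mul,
    mul_smul_comm, smul_mul_assoc, mul_assoc, smul_add, smul_smul, hz']
  simp only [pow_succ y1 b, mul_assoc, (pow_succ' y1 b).symm]
  have e2 : ∀ t, y1 ^ b * (y1 * t) = y1 * (y1 ^ b * t) := fun t => by
    rw [← mul_assoc, ← mul_assoc, (Commute.self_pow y1 b).eq]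
  simp only [e2]

end formula

section model

/-- The model space. -/
def M (k : Type) [Field k] : Type := (ℕ × ℕ × ℕ × ℕ × ℕ) →₀ k

noncomputable instance : AddCommGroup (M k) :=
  inferInstanceAs (AddCommGroup ((ℕ × ℕ × ℕ × ℕ × ℕ) →₀ k))

noncomputable instance : Module k (M k) :=
  inferInstanceAs (Module k ((ℕ × ℕ × ℕ × ℕ × ℕ) →₀ k))

/-- basis vectors -/
noncomputable def e (k : Type) [Field k] (a b c d f : ℕ) : M k := Finsupp.single (a, b, c, d, f) 1

/-- operator from values on the basis -/
noncomputable def op {N : Type*} [AddCommGroup N] [Module k N]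
    (g : ℕ → ℕ → ℕ → ℕ → ℕ → N) : M k →ₗ[k] N :=
  Finsupp.linearCombination k (fun v => g v.1 v.2.1 v.2.2.1 v.2.2.2.1 v.2.2.2.2)

lemma op_e {N : Type*} [AddCommGroup N] [Module k N]
    (g : ℕ → ℕ → ℕ → ℕ → ℕ → N) (a b c d f : ℕ) : op g (e k a b c d f) = g a b c d f :=
  (Finsupp.linearCombination_single k (1 : k) (a, b, c, d, f)).trans (one_smul _ _)

lemma op_ext {N : Type*} [AddCommGroup N] [Module k N] {g h : M k →ₗ[k] N}
    (H : ∀ a b c d f, g (e k a b c d f) = h (e k a b c d f)) : g = h := by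
  refine Finsupp.lhom_ext (M := k) (φ := g) (ψ := h) ?_
  rintro ⟨a, b, c, d, f⟩ t
  have : Finsupp.single (a, b, c, d, f) t = t • e k a b c d f :=
    (Finsupp.smul_single_one _ _).symm
  rw [this]
  exact ((g.map_smul _ _).trans (by rw [H])).trans (h.map_smul _ _).symm

/-- `x₁` on the model -/
noncomputable def X (k : Type) [Field k] : Module.End k (M k) := op fun a b c d f => e k (a + 1) b c d f
/-- `x₂` on the model -/
noncomputable def Y (k : Type) [Field k] : Module.End k (M k) := op fun a b c d f =>
  ((-1 : k) ^ a * (-1) ^ c) • e k a b c d (f + 1)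
      + ((-1) ^ a * (-2 * oc k c)) • e k a (b + 1) (c - 1) d (f + 1 + 1)
      + ((-1) ^ a * oc k c) • e k a b (c - 1) (d + 1) f
      + ((-1) ^ a * oc k b) • e k a (b - 1) (c + 1) d f
      + oc k a • e k (a - 1) (b + 1) c d f
/-- `x₂²` on the model -/
noncomputable def W (k : Type) [Field k] : Module.End k (M k) := op fun a b c d f =>
  ((-1 : k) ^ b * (-1) ^ c) • e k a b c d (f + 1 + 1)
      + oc k b • e k a (b - 1) c (d + 1) f
      + ((-1) ^ b * oc k a) • e k (a - 1) b (c + 1) d f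
/-- shift -/
noncomputable def S1 (k : Type) [Field k] : Module.End k (M k) := op fun a b c d f => e k a (b + 1) c d f
/-- shift -/
noncomputable def S3 (k : Type) [Field k] : Module.End k (M k) := op fun a b c d f => e k a b c (d + 1) f
/-- down shift -/
noncomputable def T3 (k : Type) [Field k] : Module.End k (M k) := op fun a b c d f => e k a b c (d - 1) f
/-- grading scaling -/
noncomputable def P (p : k) : Module.End k (M k) :=
  op fun a b c d f => p ^ (a + b + c + d) • e k a b c d f

lemma S1_eq : Y k * X k + X k * Y k = S1 k := by
  apply op_ext
  intro a b c d f
  simp only [LinearMap.add_apply, Module.End.mul_apply, X, Y, S1, op_e, map_add, map_smul]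
  cases a with
  | zero => simp [oc]; module
  | succ a => simp only [oc, Nat.add_sub_cancel]; module

lemma oc_two (m : ℕ) : oc k (2 * m) = 0 := by
  induction m with
  | zero => rfl
  | succ m ih =>
    have : 2 * (m + 1) = 2 * m + 1 + 1 := by ring
    rw [this, oc, oc, ih]; ring

lemma W_eq : Y k * Y k = W k := by
  apply op_ext
  intro a b c d f
  have ho : ∀ m, oc k (2 * m) = 0 := oc_two
  obtain ⟨m, rfl | rfl⟩ := Nat.even_or_odd' a <;>
  obtain ⟨n, rfl | rfl⟩ := Nat.even_or_odd' b <;>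
  obtain ⟨l, rfl | rfl⟩ := Nat.even_or_odd' c <;>
  simp only [Module.End.mul_apply, W, Y, op_e, map_add, map_smul, oc_sign, oc, ho,
    Nat.add_sub_cancel, mul_zero, zero_smul, add_zero, sub_self] <;>
  module

lemma S3_eq : W k * S1 k + S1 k * W k = S3 k := by
  apply op_ext
  intro a b c d f
  simp only [LinearMap.add_apply, Module.End.mul_apply, W, S1, S3, op_e, map_add, map_smul]
  cases b with
  | zero => simp [oc]; module
  | succ b => simp only [oc, Nat.add_sub_cancel, oc_sign]; module

lemma rel_model : Rel (1 : k) (X k) (Y k) ∧ zE (1 : k) (X k) (Y k) = S3 k := by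
  have h1 := S1_eq (k := k)
  have h2 := W_eq (k := k)
  have h3 := S3_eq (k := k)
  have hz : zE (1 : k) (X k) (Y k) = S3 k := by
    rw [← h3, ← h2, ← h1]
    simp only [zE, one_pow, one_smul]
    noncomm_ring
  have zx : S3 k * X k = X k * S3 k := op_ext fun a b c d f => by
    simp only [Module.End.mul_apply, X, S3, op_e]
  have zy : S3 k * Y k = Y k * S3 k := op_ext fun a b c d f => by
    simp only [Module.End.mul_apply, Y, S3, op_e, map_add, map_smul]
  have yx : S1 k * X k = X k * S1 k := op_ext fun a b c d f => by
    simp only [Module.End.mul_apply, X, S1, op_e]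
  refine ⟨?_, hz⟩
  rw [← hz] at zx zy
  rw [← h1] at yx
  clear h1 h2 h3 hz
  generalize X k = x at *
  generalize Y k = y at *
  have r1 : y * x ^ 2 = x ^ 2 * y := by
    linear_combination (norm := noncomm_ring) yx
  have r1' : y ^ 3 * x ^ 2 = x ^ 2 * y ^ 3 := Commute.pow_left r1 3
  simp only [zE, one_pow, one_smul] at zx zy
  refine ⟨?_, ?_, ?_⟩ <;> simp only [one_pow, one_smul]
  · exact r1
  · linear_combination (norm := noncomm_ring) zx - r1'
  · linear_combination (norm := noncomm_ring) -zy

lemma P_X (p : k) : P p * X k = p • (X k * P p) := op_ext fun a b c d f => by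
  simp only [Module.End.mul_apply, LinearMap.smul_apply, X, P, op_e, map_smul, smul_smul]
  congr 1; ring

lemma P_Y (p : k) : P p * Y k = Y k * P p := op_ext fun a b c d f => by
  simp only [Module.End.mul_apply, Y, P, op_e, map_smul, map_add]
  rcases a with _ | a <;> rcases b with _ | b <;> rcases c with _ | c <;>
  simp only [oc, zero_smul, mul_zero, Nat.add_sub_cancel] <;> module

lemma P_inv {p : k} (hp : p ≠ 0) : P p⁻¹ * P p = 1 := op_ext fun a b c d f => by
  simp only [Module.End.mul_apply, P, op_e, map_smul, smul_smul, ← mul_pow, mul_inv_cancel₀ hp,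
    one_pow, one_smul, Module.End.one_apply]

lemma T3_S3 : T3 k * S3 k = 1 := op_ext fun a b c d f => by
  simp only [Module.End.mul_apply, T3, S3, op_e, Nat.add_sub_cancel, Module.End.one_apply]

lemma model_z_inj {p : k} (hp : p ≠ 0) (m : M k)
    (h : zE p (X k) (Y k * P p) m = 0) : m = 0 := by
  have ht := twist_z (p := (1 : k)) (P_X p) (P_Y p)
  rw [one_mul, rel_model.2] at ht
  rw [ht] at h
  simp only [LinearMap.smul_apply, Module.End.mul_apply] at h
  have h' := (smul_eq_zero.1 h).resolve_left (pow_ne_zero 3 hp)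
  have h2 := congrArg (T3 k) h'
  rw [← Module.End.mul_apply, T3_S3, Module.End.one_apply, map_zero] at h2
  have inj : ∀ m, P p m = 0 → m = 0 := fun m hm => by
    have := congrArg (P p⁻¹) hm
    rwa [← Module.End.mul_apply, P_inv hp, Module.End.one_apply, map_zero] at this
  simp only [pow_succ, pow_zero, one_mul, Module.End.mul_apply] at h2
  exact inj _ (inj _ (inj _ h2))

end model


section quot
variable (p : k)

/-- generator in the quotient -/
noncomputable def q1 : AlgA k p := RingQuot.mkAlgHom k (relA k p) (x1 k)
/-- generator in the quotient -/
noncomputable def q2 : AlgA k p := RingQuot.mkAlgHom k (relA k p) (x2 k)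

lemma q_z : RingQuot.mkAlgHom k (relA k p) (zElt k p) = zE p (q1 p) (q2 p) := by
  simp only [zElt, zE, q1, q2, map_add, map_mul, map_smul, map_pow]

lemma q_rel : Rel p (q1 p) (q2 p) := by
  refine ⟨?_, ?_, ?_⟩
  · have := RingQuot.mkAlgHom_rel k (s := relA k p) (Or.inl ⟨rfl, rfl⟩)
    simpa only [q1, q2, map_add, map_mul, map_smul, map_pow] using this
  · have := RingQuot.mkAlgHom_rel k (s := relA k p) (Or.inr (Or.inl ⟨rfl, rfl⟩))
    simpa only [q1, q2, map_add, map_mul, map_smul, map_pow] using this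
  · have := RingQuot.mkAlgHom_rel k (s := relA k p) (Or.inr (Or.inr ⟨rfl, rfl⟩))
    simpa only [q1, q2, map_add, map_mul, map_smul, map_pow] using this

lemma q_induction {C : AlgA k p → Prop} (h1 : C (q1 p)) (h2 : C (q2 p))
    (hc : ∀ r, C (algebraMap k _ r)) (hm : ∀ a b, C a → C b → C (a * b))
    (ha : ∀ a b, C a → C b → C (a + b)) (a : AlgA k p) : C a := by
  obtain ⟨w, rfl⟩ := RingQuot.mkAlgHom_surjective k (relA k p) a
  induction w using FreeAlgebra.induction with
  | grade0 r => rw [AlgHom.commutes]; exact hc r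
  | grade1 j => fin_cases j; exacts [h1, h2]
  | mul a b iha ihb => rw [map_mul]; exact hm _ _ iha ihb
  | add a b iha ihb => rw [map_add]; exact ha _ _ iha ihb

variable {p}

/-- universal property -/
noncomputable def qlift {R : Type*} [Ring R] [Algebra k R] {x y : R} (h : Rel p x y) :
    AlgA k p →ₐ[k] R :=
  RingQuot.liftAlgHom k ⟨FreeAlgebra.lift k ![x, y], by
    rintro _ _ (⟨rfl, rfl⟩ | ⟨rfl, rfl⟩ | ⟨rfl, rfl⟩)
    · simpa [x1, x2] using h.r1
    · simpa [x1, x2] using h.r2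
    · simpa [x1, x2] using h.r3⟩

lemma qlift_q1 {R : Type*} [Ring R] [Algebra k R] {x y : R} (h : Rel p x y) :
    qlift h (q1 p) = x := by
  simp [qlift, q1, x1]

lemma qlift_q2 {R : Type*} [Ring R] [Algebra k R] {x y : R} (h : Rel p x y) :
    qlift h (q2 p) = y := by
  simp [qlift, q2, x2]

lemma rel_scale {R : Type*} [Ring R] [Algebra k R] {x y : R} (h : Rel p x y) (u v : k) :
    Rel p (u • x) (v • y) := by
  obtain ⟨r1, r2, r3⟩ := h
  refine ⟨?_, ?_, ?_⟩
  · simp only [smul_pow, smul_mul_assoc, mul_smul_comm, r1]; module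
  · have := congrArg (fun t => (u ^ 2 * v ^ 3) • t) r2
    simp only [smul_pow, smul_mul_assoc, mul_smul_comm, smul_add] at this ⊢
    linear_combination (norm := module) this
  · simp only [smul_pow, smul_mul_assoc, mul_smul_comm, r3]; module

variable (p) in
/-- scaling endomorphism -/
noncomputable def scale (u v : k) : AlgA k p →ₐ[k] AlgA k p := qlift (rel_scale (q_rel p) u v)

lemma scale_q1 (u v : k) : scale p u v (q1 p) = u • q1 p := qlift_q1 _
lemma scale_q2 (u v : k) : scale p u v (q2 p) = v • q2 p := qlift_q2 _

lemma scale_inv {u v : k} (hu : u ≠ 0) (hv : v ≠ 0) (a : AlgA k p) :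
    scale p u v (scale p u⁻¹ v⁻¹ a) = a := by
  induction a using q_induction with
  | h1 => rw [scale_q1, map_smul, scale_q1, inv_smul_smul₀ hu]
  | h2 => rw [scale_q2, map_smul, scale_q2, inv_smul_smul₀ hv]
  | hc r => rw [AlgHom.commutes, AlgHom.commutes]
  | hm a b ha hb => rw [map_mul, map_mul, ha, hb]
  | ha a b ha hb => rw [map_add, map_add, ha, hb]

lemma z_comm (hp : p ≠ 0) (a : AlgA k p) :
    zE p (q1 p) (q2 p) * a = scale p (p ^ 3) p⁻¹ a * zE p (q1 p) (q2 p) := by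
  induction a using q_induction with
  | h1 => rw [scale_q1, smul_mul_assoc, z_x (q_rel p)]
  | h2 => rw [scale_q2, smul_mul_assoc, z_y (q_rel p), inv_smul_smul₀ hp]
  | hc r => rw [AlgHom.commutes, Algebra.commutes]
  | hm a b ha hb => rw [map_mul, ← mul_assoc, ha, mul_assoc, hb, mul_assoc]
  | ha a b ha hb => rw [map_add, mul_add, ha, hb, add_mul]

/-- left multiplication -/
noncomputable abbrev L : AlgA k p →ₐ[k] Module.End k (AlgA k p) := Algebra.lmul k (AlgA k p)

lemma L_rel : Rel p (L (q1 p)) (L (q2 p)) := by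
  obtain ⟨r1, r2, r3⟩ := q_rel p
  refine ⟨?_, ?_, ?_⟩
  · simpa only [map_add, map_mul, map_smul, map_pow] using congrArg (L (p := p)) r1
  · simpa only [map_add, map_mul, map_smul, map_pow] using congrArg (L (p := p)) r2
  · simpa only [map_add, map_mul, map_smul, map_pow] using congrArg (L (p := p)) r3

/-- General form of the comparison map. -/
lemma exists_phi_gen {V : Type*} [AddCommGroup V] [Module k V] (hp : p ≠ 0)
    (Q A B : Module.End k V) (v : V)
    (hQ1 : Q * A = p⁻¹ • (A * Q)) (hQ2 : Q * B = B * Q) (hQv : Q v = v) (hL : Rel p A B) :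
    ∃ φ : M k →ₗ[k] V, φ (e k 0 0 0 0 0) = v ∧ (∀ m, φ (X k m) = A (φ m)) ∧
    (∀ m, φ ((Y k * P p) m) = B (φ m)) := by
  have hrel := twist_rel hQ1 hQ2 hL
  rw [mul_inv_cancel₀ hp] at hrel
  obtain ⟨y1, y2, hc⟩ := mk_comm hrel
  have hz : zE (1 : k) (A) (B * Q) = zE (1 : k) (A) (B * Q) := rfl
  generalize zE (1 : k) (A) (B * Q) = z at *
  have hQY : Q * (B * Q) = (1 : k) • ((B * Q) * Q) := by
    rw [← mul_assoc, hQ2, one_smul]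
  have tm : ∀ {s t : k} {g h : Module.End k (V)}, Q * g = s • (g * Q) → Q * h = t • (h * Q) →
      Q * (g * h) = (s * t) • (g * h * Q) := by
    intro s t g h hg hh
    rw [← mul_assoc, hg, smul_mul_assoc, mul_assoc, hh, mul_smul_comm, smul_smul, mul_assoc]
  have ta : ∀ {s : k} {g h : Module.End k (V)}, Q * g = s • (g * Q) → Q * h = s • (h * Q) →
      Q * (g + h) = s • ((g + h) * Q) := by
    intro s g h hg hh
    rw [mul_add, hg, hh, add_mul, smul_add]
  have ts : ∀ {s : k} {g h : Module.End k (V)}, Q * g = s • (g * Q) → Q * h = s • (h * Q) →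
      Q * (g - h) = s • ((g - h) * Q) := by
    intro s g h hg hh
    rw [mul_sub, hg, hh, sub_mul, smul_sub]
  have tp : ∀ {s : k} {g : Module.End k (V)}, Q * g = s • (g * Q) → ∀ n,
      Q * g ^ n = s ^ n • (g ^ n * Q) := by
    intro s g hg n
    induction n with
    | zero => simp
    | succ n ih => rw [pow_succ, tm ih hg, pow_succ]
  set x' := A
  set y' := B * Q with hy'
  have t1 : Q * y1 = p⁻¹ • (y1 * Q) := by
    have : y1 = y' * x' + x' * y' := by rw [hc.a0]; abel
    rw [this]
    refine ta ?_ ?_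
    · simpa using tm hQY hQ1
    · simpa using tm hQ1 hQY
  have t2 : Q * y2 = p⁻¹ • (y2 * Q) := by
    have : y2 = y' * y1 - y1 * y' := by rw [hc.a1]; abel
    rw [this]
    refine ts ?_ ?_
    · simpa using tm hQY t1
    · simpa using tm t1 hQY
  have t3 : Q * z = p⁻¹ • (z * Q) := by
    have : z = y' * y2 + y2 * y' + (y1 * (y' * y') + y1 * (y' * y')) := by
      rw [hc.a2]; noncomm_ring
    rw [this]
    have hyy := tm t1 (tm hQY hQY)
    refine ta (ta ?_ ?_) (ta ?_ ?_)
    · simpa using tm hQY t2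
    · simpa using tm t2 hQY
    · simpa using hyy
    · simpa using hyy
  have tmon : ∀ a b c d f, Q * mon x' y' y1 y2 z a b c d f =
      (p⁻¹) ^ (a + b + c + d) • (mon x' y' y1 y2 z a b c d f * Q) := by
    intro a b c d f
    have := tm (tm (tm (tm (tp hQ1 a) (tp t1 b)) (tp t2 c)) (tp t3 d)) (tp hQY f)
    rw [one_pow, mul_one, ← pow_add, ← pow_add, ← pow_add] at this
    exact this
  refine ⟨op fun a b c d f => mon x' y' y1 y2 z a b c d f v, ?_, ?_, ?_⟩
  · rw [op_e]; simp [mon]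
  · intro m
    refine LinearMap.congr_fun (f := (op fun a b c d f => mon x' y' y1 y2 z a b c d f v) ∘ₗ X k)
      (g := A ∘ₗ (op fun a b c d f => mon x' y' y1 y2 z a b c d f v))
      (op_ext fun a b c d f => ?_) m
    simp only [LinearMap.comp_apply, X, op_e]
    rw [← x_mon]; rfl
  · intro m
    refine LinearMap.congr_fun (f := (op fun a b c d f => mon x' y' y1 y2 z a b c d f v) ∘ₗ (Y k * P p))
      (g := B ∘ₗ (op fun a b c d f => mon x' y' y1 y2 z a b c d f v))
      (op_ext fun a b c d f => ?_) m
    simp only [LinearMap.comp_apply, Module.End.mul_apply, Y, P, op_e, map_smul, map_add]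
    have key := LinearMap.congr_fun (y_mon (k := k) hc a b c d f) v
    have hQm := LinearMap.congr_fun (tmon a b c d f) v
    simp only [LinearMap.add_apply, LinearMap.smul_apply] at key
    rw [← key, hy', mul_assoc (B), ← hy', Module.End.mul_apply, hQm, LinearMap.smul_apply,
      Module.End.mul_apply, hQv, map_smul, smul_smul, ← mul_pow, mul_inv_cancel₀ hp, one_pow,
      one_smul]

/-- The model detects elements. -/
lemma exists_phi (hp : p ≠ 0) : ∃ φ : M k →ₗ[k] AlgA k p,
    φ (e k 0 0 0 0 0) = 1 ∧ (∀ m, φ (X k m) = q1 p * φ m) ∧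
    (∀ m, φ ((Y k * P p) m) = q2 p * φ m) := by
  let Q : Module.End k (AlgA k p) := (scale p p⁻¹ 1).toLinearMap
  have hQ1 : Q * L (q1 p) = p⁻¹ • (L (q1 p) * Q) := by
    ext a
    simp [Q, scale_q1]
  have hQ2 : Q * L (q2 p) = L (q2 p) * Q := by
    ext a
    simp [Q, scale_q2]
  have hQone : Q 1 = 1 := map_one (scale p p⁻¹ 1)
  have hL : Rel p (L (q1 p)) (L (q2 p)) := L_rel
  exact exists_phi_gen hp Q (L (q1 p)) (L (q2 p)) 1 hQ1 hQ2 hQone hL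

lemma z_reg (hp : p ≠ 0) (a : AlgA k p) (h : zE p (q1 p) (q2 p) * a = 0) : a = 0 := by
  obtain ⟨φ, h0, hX, hY⟩ := exists_phi hp
  have hrel := twist_rel (P_X p) (P_Y p) rel_model.1
  rw [one_mul] at hrel
  have hφ : ∀ a m, φ (qlift hrel a m) = a * φ m := by
    intro a
    induction a using q_induction with
    | h1 => intro m; rw [qlift_q1, hX]
    | h2 => intro m; rw [qlift_q2, hY]
    | hc r => intro m; rw [AlgHom.commutes, Module.algebraMap_end_apply, map_smul, Algebra.smul_def]
    | hm a b ha hb => intro m; rw [map_mul, Module.End.mul_apply, ha, hb, mul_assoc]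
    | ha a b ha hb => intro m; rw [map_add, LinearMap.add_apply, map_add, ha, hb, add_mul]
  have hz : qlift hrel (zE p (q1 p) (q2 p)) = zE p (X k) (Y k * P p) := by
    simp only [zE, map_add, map_mul, map_smul, map_pow, qlift_q1, qlift_q2]
  have h1 := congrArg (fun t => qlift hrel t (e k 0 0 0 0 0)) h
  simp only [map_mul, map_zero, LinearMap.zero_apply, Module.End.mul_apply, hz] at h1
  have h2 := model_z_inj hp _ h1
  have h3 := hφ a (e k 0 0 0 0 0)
  rw [h2, map_zero, h0, mul_one] at h3
  exact h3.symm

end quot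

end helpers

/-- for `p ≠ 0`, the image of
`z = x₂³x₁ + p x₂²x₁x₂ + p² x₂x₁x₂² + p³ x₁x₂³` in `𝒜(p)` is a regular normal
element. -/
theorem stmt_14 [IsAlgClosed k] [CharZero k] (p : k) (hp : p ≠ 0) :
    (∀ a : AlgA k p, (∃ b, RingQuot.mkAlgHom k (relA k p) (zElt k p) * a =
        b * RingQuot.mkAlgHom k (relA k p) (zElt k p)) ∧
      (∃ c, a * RingQuot.mkAlgHom k (relA k p) (zElt k p) =
        RingQuot.mkAlgHom k (relA k p) (zElt k p) * c)) ∧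
    (∀ a : AlgA k p, RingQuot.mkAlgHom k (relA k p) (zElt k p) * a = 0 → a = 0) ∧
    (∀ a : AlgA k p, a * RingQuot.mkAlgHom k (relA k p) (zElt k p) = 0 → a = 0) := by
  rw [q_z]
  have hc : ∀ a : AlgA k p, a * zE p (q1 p) (q2 p) =
      zE p (q1 p) (q2 p) * scale p (p ^ 3)⁻¹ (p⁻¹)⁻¹ a := fun a => by
    rw [z_comm hp, scale_inv (pow_ne_zero 3 hp) (inv_ne_zero hp)]
  refine ⟨fun a => ⟨⟨_, z_comm hp a⟩, ⟨_, hc a⟩⟩, z_reg hp, fun a h => ?_⟩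
  rw [hc] at h
  have h' := z_reg hp _ h
  rw [← scale_inv (pow_ne_zero 3 hp) (inv_ne_zero hp) a, h', map_zero]

end Stmt14
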